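/- arXiv:2103.03346 — 2 statements merged into one kernel-verified Lean document; each statement's English description precedes it below -/
import Mathlib

section
/- Let m ≥ 2 be an integer. For every feasible schedule σ on m machines there exists a feasible schedule σ' on 2 machines such that F(σ) ≤ (m/2)·F(σ'). Consequently, the maximum of F over feasible schedules on m machines is at most m/2 times the maximum of F over feasible schedules on 2 machines. (The schedule σ' can be obtained by keeping, in each time slot of σ, at most two jobs of largest weight.) -/
/-- A feasible schedule on `m` machines with deadline `D` for the job set `N`
(UET jobs) subject to the conflict graph `G`: `S t` is the set of jobs processed
in time slot `[t-1, t]`; the slots are pairwise disjoint subsets of `N`, each of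
cardinality at most `m`, and no two jobs in the same slot are in conflict. -/
def Feasible (N : Finset ℕ) (G : SimpleGraph ℕ) (m D : ℕ)
    (S : Fin D → Finset ℕ) : Prop :=
  (∀ t, S t ⊆ N) ∧
  (∀ t t' : Fin D, t ≠ t' → Disjoint (S t) (S t')) ∧
  (∀ t, (S t).card ≤ m) ∧
  (∀ t, ∀ a ∈ S t, ∀ b ∈ S t, ¬ G.Adj a b)

/-- The set `J(σ)` of on-time jobs of a schedule. -/
def onTime {D : ℕ} (S : Fin D → Finset ℕ) : Finset ℕ :=
  Finset.univ.biUnion S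

/-- The total weight `F(σ)` of on-time jobs. -/
noncomputable def Fval {D : ℕ} (w : ℕ → ℝ) (S : Fin D → Finset ℕ) : ℝ :=
  ∑ j ∈ onTime S, w j

/-- Two elements of largest weight carry at least a `2 / m` fraction of the total weight of a
finite set with at most `m` elements. -/
theorem exists_subset_card_le_two_sum_le {α : Type*} [DecidableEq α] (s : Finset α) (w : α → ℝ)
    (hw : ∀ j ∈ s, 0 ≤ w j) (m : ℕ) (hm : 2 ≤ m) (hs : s.card ≤ m) :
    ∃ t ⊆ s, t.card ≤ 2 ∧ ∑ j ∈ s, w j ≤ ((m : ℝ) / 2) * ∑ j ∈ t, w j := by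
  have hm' : (2 : ℝ) ≤ m := by exact_mod_cast hm
  rcases Nat.lt_or_ge s.card 2 with hlt | hge
  · refine ⟨s, subset_rfl, hlt.le, ?_⟩
    exact le_mul_of_one_le_left (Finset.sum_nonneg hw) (by linarith)
  · obtain ⟨a, ha, hmax⟩ := s.exists_max_image w (Finset.card_pos.mp (by omega))
    have hcard := Finset.card_erase_add_one ha
    obtain ⟨b, hb, hmax'⟩ :=
      (s.erase a).exists_max_image w (Finset.card_pos.mp (by omega))
    have hbs := Finset.mem_of_mem_erase hb
    refine ⟨{a, b}, by simp [Finset.insert_subset_iff, ha, hbs], Finset.card_le_two, ?_⟩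
    rw [Finset.sum_pair (Finset.ne_of_mem_erase hb).symm, ← Finset.add_sum_erase s w ha]
    have hrest := Finset.sum_le_card_nsmul (s.erase a) w (w b) hmax'
    rw [nsmul_eq_mul] at hrest
    have hk : ((s.erase a).card : ℝ) ≤ m - 1 := by
      have : ((s.erase a).card : ℝ) + 1 ≤ m := by exact_mod_cast hcard.trans_le hs
      linarith
    have hkb := mul_le_mul_of_nonneg_right hk (hw b hbs)
    nlinarith [mul_nonneg (sub_nonneg.mpr hm') (sub_nonneg.mpr (hmax b hbs))]

/-- The total weight of on-time jobs is the sum over the time slots of their weights. -/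
theorem Fval_eq_sum_slots {D : ℕ} (w : ℕ → ℝ) (S : Fin D → Finset ℕ)
    (hS : ∀ t t' : Fin D, t ≠ t' → Disjoint (S t) (S t')) :
    Fval w S = ∑ t, ∑ j ∈ S t, w j :=
  Finset.sum_biUnion fun t _ t' _ h => hS t t' h

/-- For every feasible schedule `σ` on `m ≥ 2` machines there is a feasible
schedule `σ'` on 2 machines with `F(σ) ≤ (m/2)·F(σ')`. -/
theorem exists_two_machine_schedule_half_m
    (N : Finset ℕ) (G : SimpleGraph ℕ) (w : ℕ → ℝ)
    (hw : ∀ j ∈ N, 0 ≤ w j) (m D : ℕ) (hm : 2 ≤ m) (hD : 1 ≤ D)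
    (σ : Fin D → Finset ℕ) (hσ : Feasible N G m D σ) :
    ∃ σ' : Fin D → Finset ℕ, Feasible N G 2 D σ' ∧
      Fval w σ ≤ ((m : ℝ) / 2) * Fval w σ' := by
  obtain ⟨hN, hdisj, hcard, hG⟩ := hσ
  choose σ' hsub hcard' hsum using fun t =>
    exists_subset_card_le_two_sum_le (σ t) w (fun j hj => hw j (hN t hj)) m hm (hcard t)
  have hdisj' : ∀ t t' : Fin D, t ≠ t' → Disjoint (σ' t) (σ' t') := fun t t' h =>
    Finset.disjoint_of_subset_left (hsub t)
      (Finset.disjoint_of_subset_right (hsub t') (hdisj t t' h))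
  refine ⟨σ', ⟨fun t => (hsub t).trans (hN t), hdisj', hcard',
    fun t a ha b hb => hG t a (hsub t ha) b (hsub t hb)⟩, ?_⟩
  rw [Fval_eq_sum_slots w σ hdisj, Fval_eq_sum_slots w σ' hdisj', Finset.mul_sum]
  exact Finset.sum_le_sum fun t _ => hsum t
end

section
/- The performance guarantee m/2 is tight: for every integer m ≥ 3, every integer D ≥ 1, and every real ε with 0 < ε ≤ 1/2, there exist a finite job set N, a conflict graph G on N, positive weights w_j, and a feasible schedule σ* on m machines such that for every optimal 2-machine schedule σ₂ and every feasible schedule σ^A on m machines with J(σ₂) ⊆ J(σ^A), one has F(σ*) > (m/2 − ε)·F(σ^A). -/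
/-- The conflict graph in which each job `j < D` conflicts with every other job, and
there are no further conflicts. -/
def heavyConflict (D : ℕ) : SimpleGraph ℕ where
  Adj a b := a ≠ b ∧ (a < D ∨ b < D)
  symm := ⟨fun _ _ h => ⟨h.1.symm, h.2.symm⟩⟩
  loopless := ⟨fun _ h => h.1 rfl⟩

/-- Jobs `j < D` have weight `c`, all others have weight `1`. -/
noncomputable def heavyWeight (D : ℕ) (c : ℝ) (j : ℕ) : ℝ :=
  if j < D then c else 1

theorem Fval_eq_sum {N : Finset ℕ} {G : SimpleGraph ℕ} {m D : ℕ} {S : Fin D → Finset ℕ}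
    (hS : Feasible N G m D S) (w : ℕ → ℝ) : Fval w S = ∑ t, ∑ j ∈ S t, w j :=
  Finset.sum_biUnion fun t _ t' _ h => hS.2.1 t t' h

theorem mem_onTime {D : ℕ} {S : Fin D → Finset ℕ} {j : ℕ} :
    j ∈ onTime S ↔ ∃ t, j ∈ S t := by
  simp [onTime]

section HeavyInstance

variable {N : Finset ℕ} {m D : ℕ} {S : Fin D → Finset ℕ}

/-- A heavy job is alone in its slot. -/
theorem eq_singleton_of_heavy_mem (hS : Feasible N (heavyConflict D) m D S) {t : Fin D} {h : ℕ}
    (hh : h < D) (ht : h ∈ S t) : S t = {h} := by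
  refine Finset.eq_singleton_iff_unique_mem.2 ⟨ht, fun x hx => ?_⟩
  by_contra hne
  exact hS.2.2.2 t x hx h ht ⟨hne, Or.inr hh⟩

theorem slot_weight_of_heavy_mem (hS : Feasible N (heavyConflict D) m D S) (c : ℝ) {t : Fin D}
    {h : ℕ} (hh : h < D) (ht : h ∈ S t) : ∑ j ∈ S t, heavyWeight D c j = c := by
  simp [eq_singleton_of_heavy_mem hS hh ht, heavyWeight, hh]

/-- Without heavy jobs, a slot weighs at most the number of machines. -/
theorem slot_weight_le_of_no_heavy (hS : Feasible N (heavyConflict D) m D S) (c : ℝ) {t : Fin D}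
    (ht : ∀ h ∈ S t, ¬ h < D) : ∑ j ∈ S t, heavyWeight D c j ≤ m := by
  have : ∑ j ∈ S t, heavyWeight D c j = (S t).card := by
    have hlight : ∀ j ∈ S t, heavyWeight D c j = 1 := fun j hj => if_neg (ht j hj)
    simp [Finset.sum_congr rfl hlight]
  rw [this]
  exact_mod_cast hS.2.2.1 t

/-- A 2-machine schedule of weight at least `D * c`, where `c > 2`, schedules all heavy jobs. -/
theorem heavy_mem_onTime {c : ℝ} (hc : 2 < c) (hS : Feasible N (heavyConflict D) 2 D S)
    (hF : D * c ≤ Fval (heavyWeight D c) S) (h : Fin D) : (h : ℕ) ∈ onTime S := by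
  have hle : ∀ t, ∑ j ∈ S t, heavyWeight D c j ≤ c := fun t => by
    by_cases ht : ∃ h ∈ S t, h < D
    · obtain ⟨h, ht, hh⟩ := ht
      exact (slot_weight_of_heavy_mem hS c hh ht).le
    · push Not at ht
      have := slot_weight_le_of_no_heavy hS c fun h hh => (ht h hh).not_gt
      push_cast at this
      linarith
  have hex : ∀ t, ∃ h : Fin D, (h : ℕ) ∈ S t := by
    by_contra! hcon
    obtain ⟨t, ht⟩ := hcon
    have hlt : ∑ j ∈ S t, heavyWeight D c j < c := by
      have := slot_weight_le_of_no_heavy hS c fun h hh hD => ht ⟨h, hD⟩ hh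
      push_cast at this
      linarith
    have := Finset.sum_lt_sum (fun t _ => hle t) ⟨t, Finset.mem_univ t, hlt⟩
    rw [← Fval_eq_sum hS] at this
    simp at this
    linarith
  choose f hf using hex
  have hinj : Function.Injective f := fun t t' htt => by
    by_contra hne
    exact Finset.disjoint_left.1 (hS.2.1 t t' hne) (hf t) (htt ▸ hf t')
  obtain ⟨t, rfl⟩ := Finite.surjective_of_injective hinj h
  exact mem_onTime.2 ⟨t, hf t⟩

/-- A schedule containing all heavy jobs contains nothing else. -/
theorem Fval_of_heavy_subset (c : ℝ) (hS : Feasible N (heavyConflict D) m D S)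
    (hJ : ∀ h : Fin D, (h : ℕ) ∈ onTime S) : Fval (heavyWeight D c) S = D * c := by
  choose f hf using fun h => mem_onTime.1 (hJ h)
  have hinj : Function.Injective f := fun h h' hhh => by
    have h1 := hf h'
    rw [← hhh, eq_singleton_of_heavy_mem hS h.2 (hf h), Finset.mem_singleton] at h1
    exact Fin.ext h1.symm
  have hslot : ∀ t, ∑ j ∈ S t, heavyWeight D c j = c := fun t => by
    obtain ⟨h, rfl⟩ := Finite.surjective_of_injective hinj t
    exact slot_weight_of_heavy_mem hS c h.2 (hf h)
  simp [Fval_eq_sum hS, hslot]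

/-- One heavy job in each slot. -/
theorem feasible_heavy (hN : Finset.range D ⊆ N) (hm : 1 ≤ m) :
    Feasible N (heavyConflict D) m D fun t => {(t : ℕ)} := by
  refine ⟨fun t => ?_, fun t t' h => ?_, fun t => by simpa using hm, fun t a ha b hb => ?_⟩
  · simpa using hN (Finset.mem_range.2 t.2)
  · simpa [Fin.ext_iff] using fun h' => h (Fin.ext h')
  · rw [Finset.mem_singleton.1 ha, Finset.mem_singleton.1 hb]
    exact (heavyConflict D).irrefl

/-- All slots filled with `m` light jobs. -/
theorem feasible_light (m D : ℕ) :
    Feasible (Finset.range (D + m * D)) (heavyConflict D) m D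
      fun t => Finset.Ico (D + m * t) (D + m * (t + 1)) := by
  refine ⟨fun t j hj => ?_, fun t t' h => ?_, fun t => ?_, fun t a ha b hb => ?_⟩
  · have := Nat.mul_le_mul_left m (Nat.succ_le_of_lt t.2)
    simp only [Finset.mem_Ico, Finset.mem_range, Nat.succ_eq_add_one] at *
    omega
  · rw [Finset.disjoint_left]
    intro j hj hj'
    rw [Finset.mem_Ico] at hj hj'
    rcases lt_or_gt_of_ne (Fin.val_ne_of_ne h) with hlt | hlt
    all_goals
      have := Nat.mul_le_mul_left m (Nat.succ_le_of_lt hlt)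
      simp only [Nat.succ_eq_add_one] at this
      omega
  · rw [Nat.card_Ico, mul_add, mul_one]
    omega
  · rw [Finset.mem_Ico] at ha hb
    rintro ⟨-, h | h⟩ <;> omega

theorem Fval_light (m D : ℕ) (c : ℝ) :
    Fval (heavyWeight D c) (fun t : Fin D => Finset.Ico (D + m * t) (D + m * (t + 1)))
      = D * m := by
  have hslot : ∀ t : Fin D,
      ∑ j ∈ Finset.Ico (D + m * t) (D + m * (t + 1)), heavyWeight D c j = m := fun t => by
    have hlight : ∀ j ∈ Finset.Ico (D + m * (t : ℕ)) (D + m * (t + 1)), heavyWeight D c j = 1 :=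
      fun j hj => if_neg (by rw [Finset.mem_Ico] at hj; omega)
    rw [Finset.sum_congr rfl hlight, Finset.sum_const, Nat.card_Ico,
      show D + m * ((t : ℕ) + 1) - (D + m * t) = m by rw [mul_add, mul_one]; omega]
    simp
  simp [Fval_eq_sum (feasible_light m D), hslot]

end HeavyInstance

/-- Tightness of the `m/2` performance guarantee: for every `m ≥ 3`, `D ≥ 1`
and `0 < ε ≤ 1/2` there is an instance (job set `N`, conflict graph `G`,
positive weights `w`) and a feasible schedule `σ*` on `m` machines such that for
every optimal 2-machine schedule `σ₂` and every feasible `m`-machine schedule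
`σ^A` with `J(σ₂) ⊆ J(σ^A)` one has `F(σ*) > (m/2 - ε)·F(σ^A)`. -/
theorem tightness_of_half_m_guarantee
    (m D : ℕ) (hm : 3 ≤ m) (hD : 1 ≤ D) (ε : ℝ) (hε : 0 < ε) (hε' : ε ≤ 1 / 2) :
    ∃ (N : Finset ℕ) (G : SimpleGraph ℕ) (w : ℕ → ℝ),
      (∀ j ∈ N, 0 < w j) ∧
      ∃ σs : Fin D → Finset ℕ, Feasible N G m D σs ∧
        ∀ σ₂ : Fin D → Finset ℕ, Feasible N G 2 D σ₂ →
          (∀ σ' : Fin D → Finset ℕ, Feasible N G 2 D σ' → Fval w σ' ≤ Fval w σ₂) →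
          ∀ σA : Fin D → Finset ℕ, Feasible N G m D σA → onTime σ₂ ⊆ onTime σA →
            ((m : ℝ) / 2 - ε) * Fval w σA < Fval w σs := by
  have hm0 : (3 : ℝ) ≤ m := by exact_mod_cast hm
  have hD0 : (1 : ℝ) ≤ D := by exact_mod_cast hD
  have hη : 0 < ε / m := by positivity
  set c : ℝ := 2 + ε / m with hc
  have hlt : ((m : ℝ) / 2 - ε) * c < m := by
    have : ((m : ℝ) / 2 - ε) * c = m - 3 / 2 * ε - ε * (ε / m) := by
      rw [hc]
      field_simp
      ring
    nlinarith [mul_pos hε hη]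
  refine ⟨Finset.range (D + m * D), heavyConflict D, heavyWeight D c, fun j _ => ?_,
    _, feasible_light m D, fun σ₂ h₂ hopt σA hA hsub => ?_⟩
  · unfold heavyWeight
    split_ifs <;> linarith
  · have hheavy := feasible_heavy (N := Finset.range (D + m * D)) (m := 2)
      (Finset.range_mono (Nat.le_add_right D (m * D))) one_le_two
    have hF : D * c ≤ Fval (heavyWeight D c) σ₂ := by
      rw [← Fval_of_heavy_subset c hheavy fun h => mem_onTime.2 ⟨h, by simp⟩]
      exact hopt _ hheavy
    rw [Fval_light, Fval_of_heavy_subset c hA fun h =>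
      hsub (heavy_mem_onTime (by linarith) h₂ hF h)]
    nlinarith
end
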